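/- (KT betting fraction in closed form) Let t be a positive integer, δ ≥ 0 a real number, and define the Krichevsky–Trofimov potential F_t(x) := 2^t·Γ(δ+1)·Γ((t+δ+1+x)/2)·Γ((t+δ+1−x)/2)/( Γ((δ+1)/2)²·Γ(t+δ+1) ). Then for every real z with |z| < t + δ, the betting fraction satisfies ( F_t(z+1) − F_t(z−1) )/( F_t(z+1) + F_t(z−1) ) = z/(t+δ). -/

import Mathlib

/-- The Krichevsky–Trofimov potential with time shift `δ`. -/
noncomputable def KTpot (t : ℕ) (δ x : ℝ) : ℝ :=
  2 ^ t * Real.Gamma (δ + 1) * Real.Gamma (((t : ℝ) + δ + 1 + x) / 2) *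
      Real.Gamma (((t : ℝ) + δ + 1 - x) / 2) /
    (Real.Gamma ((δ + 1) / 2) ^ 2 * Real.Gamma ((t : ℝ) + δ + 1))

/-- The KT betting fraction in closed form: for `|z| < t + δ`,
`(F_t(z+1) − F_t(z−1))/(F_t(z+1) + F_t(z−1)) = z/(t+δ)`. -/
theorem KT_betting_fraction (t : ℕ) (ht : 1 ≤ t) (δ : ℝ) (hδ : 0 ≤ δ)
    (z : ℝ) (hz : |z| < (t : ℝ) + δ) :
    (KTpot t δ (z + 1) - KTpot t δ (z - 1)) / (KTpot t δ (z + 1) + KTpot t δ (z - 1)) =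
      z / ((t : ℝ) + δ) := by
  obtain ⟨hz₁, hz₂⟩ := abs_lt.mp hz
  have ha : 0 < ((t : ℝ) + δ + z) / 2 := by linarith
  have hb : 0 < ((t : ℝ) + δ - z) / 2 := by linarith
  have hs : 0 < (t : ℝ) + δ := by linarith
  obtain ⟨K, hK, h_add, h_sub⟩ : ∃ K : ℝ, 0 < K ∧
      KTpot t δ (z + 1) = K * ((t : ℝ) + δ + z) ∧ KTpot t δ (z - 1) = K * ((t : ℝ) + δ - z) := by
    refine ⟨2 ^ t * Real.Gamma (δ + 1) * Real.Gamma (((t : ℝ) + δ + z) / 2) *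
      Real.Gamma (((t : ℝ) + δ - z) / 2) /
      (Real.Gamma ((δ + 1) / 2) ^ 2 * Real.Gamma ((t : ℝ) + δ + 1)) / 2, ?_, ?_, ?_⟩
    · have h₁ := Real.Gamma_pos_of_pos ha
      have h₂ := Real.Gamma_pos_of_pos hb
      have h₃ : 0 < Real.Gamma (δ + 1) := Real.Gamma_pos_of_pos (by linarith)
      have h₄ : 0 < Real.Gamma ((δ + 1) / 2) := Real.Gamma_pos_of_pos (by linarith)
      have h₅ : 0 < Real.Gamma ((t : ℝ) + δ + 1) := Real.Gamma_pos_of_pos (by linarith)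
      positivity
    · rw [KTpot, show ((t : ℝ) + δ + 1 + (z + 1)) / 2 = ((t : ℝ) + δ + z) / 2 + 1 by ring,
        show ((t : ℝ) + δ + 1 - (z + 1)) / 2 = ((t : ℝ) + δ - z) / 2 by ring,
        Real.Gamma_add_one ha.ne']
      ring
    · rw [KTpot, show ((t : ℝ) + δ + 1 + (z - 1)) / 2 = ((t : ℝ) + δ + z) / 2 by ring,
        show ((t : ℝ) + δ + 1 - (z - 1)) / 2 = ((t : ℝ) + δ - z) / 2 + 1 by ring,
        Real.Gamma_add_one hb.ne']
      ring
  rw [h_add, h_sub, ← mul_sub, ← mul_add, mul_div_mul_left _ _ hK.ne', div_eq_div_iff] <;> linarith
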